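/- arXiv:2008.04500 — 2 statements merged into one kernel-verified Lean document; each statement's English description precedes it below -/
import Mathlib

section
/- For μ ∈ ℝ and σ > 0, let φ_{μ,σ}(x) = (1/(σ√(2π))) · exp(−(x−μ)²/(2σ²)). Then for all μ₁, μ₂ ∈ ℝ, σ > 0, and every real α > 1, ∫_ℝ φ_{μ₁,σ}(x)^α · φ_{μ₂,σ}(x)^{1−α} dx = exp(α(α−1)(μ₁−μ₂)²/(2σ²)). Consequently, the α-Rényi divergence between the Gaussian distributions N(μ₁, σ²) and N(μ₂, σ²) equals α(μ₁−μ₂)²/(2σ²). -/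
open MeasureTheory Real

/-- Density of the one-dimensional Gaussian distribution `N(μ, σ²)`. -/
noncomputable def gaussPdf (μ σ x : ℝ) : ℝ :=
  (1 / (σ * Real.sqrt (2 * π))) * Real.exp (-(x - μ) ^ 2 / (2 * σ ^ 2))

lemma integral_gaussPdf (μ : ℝ) {σ : ℝ} (hσ : 0 < σ) : ∫ x : ℝ, gaussPdf μ σ x = 1 := by
  have hv : (σ ^ 2).toNNReal ≠ 0 := (Real.toNNReal_pos.2 (by positivity)).ne'
  rw [← ProbabilityTheory.integral_gaussianPDFReal_eq_one μ hv]
  congr 1 with x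
  have hs : Real.sqrt (2 * π * σ ^ 2) = σ * Real.sqrt (2 * π) := by
    rw [Real.sqrt_mul (by positivity), Real.sqrt_sq hσ.le, mul_comm]
  simp only [gaussPdf, ProbabilityTheory.gaussianPDFReal, Real.coe_toNNReal _ (sq_nonneg σ), hs,
    one_div]

/-- The weighted geometric mean of two Gaussian densities of equal variance is a multiple of the
Gaussian density centred at the weighted mean. -/
lemma gaussPdf_rpow_mul_rpow (μ₁ μ₂ : ℝ) {σ : ℝ} (hσ : 0 < σ) (α x : ℝ) :
    (gaussPdf μ₁ σ x) ^ α * (gaussPdf μ₂ σ x) ^ (1 - α) =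
      Real.exp (α * (α - 1) * (μ₁ - μ₂) ^ 2 / (2 * σ ^ 2)) *
        gaussPdf (α * μ₁ + (1 - α) * μ₂) σ x := by
  have hc : 0 < 1 / (σ * Real.sqrt (2 * π)) := by positivity
  unfold gaussPdf
  rw [Real.mul_rpow hc.le (Real.exp_pos _).le, Real.mul_rpow hc.le (Real.exp_pos _).le,
    ← Real.exp_mul, ← Real.exp_mul, mul_mul_mul_comm, ← Real.rpow_add hc, ← Real.exp_add,
    add_sub_cancel, Real.rpow_one, mul_left_comm, ← Real.exp_add]
  congr 2
  field_simp
  ring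

/-- The Rényi integral of two one-dimensional Gaussians of common variance `σ²`
equals `exp(α(α−1)(μ₁−μ₂)²/(2σ²))`; consequently the α-Rényi divergence between
`N(μ₁,σ²)` and `N(μ₂,σ²)` equals `α(μ₁−μ₂)²/(2σ²)`. -/
theorem gaussian_renyi_divergence (μ₁ μ₂ σ : ℝ) (hσ : 0 < σ) (α : ℝ) (hα : 1 < α) :
    (∫ x : ℝ, (gaussPdf μ₁ σ x) ^ α * (gaussPdf μ₂ σ x) ^ (1 - α)) =
      Real.exp (α * (α - 1) * (μ₁ - μ₂) ^ 2 / (2 * σ ^ 2)) ∧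
    (α - 1)⁻¹ *
        Real.log (∫ x : ℝ, (gaussPdf μ₁ σ x) ^ α * (gaussPdf μ₂ σ x) ^ (1 - α)) =
      α * (μ₁ - μ₂) ^ 2 / (2 * σ ^ 2) := by
  have key : (∫ x : ℝ, (gaussPdf μ₁ σ x) ^ α * (gaussPdf μ₂ σ x) ^ (1 - α)) =
      Real.exp (α * (α - 1) * (μ₁ - μ₂) ^ 2 / (2 * σ ^ 2)) := by
    simp_rw [gaussPdf_rpow_mul_rpow μ₁ μ₂ hσ α]
    rw [integral_const_mul, integral_gaussPdf _ hσ, mul_one]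
  refine ⟨key, ?_⟩
  have hα' : α - 1 ≠ 0 := (sub_pos.2 hα).ne'
  rw [key, Real.log_exp]
  field_simp
end

section
/- Let (Ω, 𝒜, μ) be a σ-finite measure space and let p, q : Ω → [0, ∞) be measurable functions with ∫ p dμ = ∫ q dμ = 1. Suppose there is ε ≥ 0 such that e^{−ε} q(ω) ≤ p(ω) ≤ e^{ε} q(ω) for μ-almost every ω. Then for every real α > 1, ∫ p^α q^{1−α} dμ ≤ exp(α(α−1)ε²/2); equivalently, the α-Rényi divergence D_α(p‖q) = (1/(α−1)) ln ∫ p^α q^{1−α} dμ satisfies D_α(p‖q) ≤ (ε²/2)·α. -/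
open MeasureTheory

open Real in
/-- `tanh x ≤ x` for `0 ≤ x`, in division-free form. -/
lemma sinh_le_self_mul_cosh {x : ℝ} (hx : 0 ≤ x) : sinh x ≤ x * cosh x := by
  have hd (y : ℝ) : HasDerivAt (fun z => z * cosh z - sinh z) (y * sinh y) y := by
    have h := ((hasDerivAt_id' y).mul (hasDerivAt_cosh y)).sub (hasDerivAt_sinh y)
    exact h.congr_deriv (by ring)
  have hmono : MonotoneOn (fun z => z * cosh z - sinh z) (Set.Ici 0) := by
    refine monotoneOn_of_deriv_nonneg (convex_Ici 0)
      (fun y _ => (hd y).continuousAt.continuousWithinAt)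
      (fun y _ => (hd y).differentiableAt.differentiableWithinAt) fun y hy => ?_
    rw [interior_Ici, Set.mem_Ioi] at hy
    rw [(hd y).deriv]
    exact mul_nonneg hy.le (sinh_nonneg_iff.2 hy.le)
  simpa using hmono Set.self_mem_Ici hx hx

open Real in
lemma antitoneOn_cosh_mul_exp_neg_sq :
    AntitoneOn (fun x => cosh x * exp (-(x ^ 2 / 2))) (Set.Ici 0) := by
  have hd (y : ℝ) : HasDerivAt (fun z => cosh z * exp (-(z ^ 2 / 2)))
      ((sinh y - y * cosh y) * exp (-(y ^ 2 / 2))) y := by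
    have h := (hasDerivAt_cosh y).mul (((hasDerivAt_pow 2 y).div_const 2).neg.exp)
    exact h.congr_deriv (by simp only [Pi.neg_apply]; push_cast; ring)
  refine antitoneOn_of_deriv_nonpos (convex_Ici 0)
    (fun y _ => (hd y).continuousAt.continuousWithinAt)
    (fun y _ => (hd y).differentiableAt.differentiableWithinAt) fun y hy => ?_
  rw [interior_Ici, Set.mem_Ioi] at hy
  rw [(hd y).deriv]
  exact mul_nonpos_of_nonpos_of_nonneg
    (sub_nonpos.2 (sinh_le_self_mul_cosh hy.le)) (exp_pos _).le

open Real in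
lemma cosh_le_cosh_mul_exp {x y : ℝ} (hx : 0 ≤ x) (hxy : x ≤ y) :
    cosh y ≤ cosh x * exp ((y ^ 2 - x ^ 2) / 2) := by
  have h := mul_le_mul_of_nonneg_right
    (antitoneOn_cosh_mul_exp_neg_sq hx (hx.trans hxy : (0 : ℝ) ≤ y) hxy) (exp_pos (y ^ 2 / 2)).le
  simp only [mul_assoc, ← exp_add] at h
  rw [neg_add_cancel, exp_zero, mul_one] at h
  rwa [show (y ^ 2 - x ^ 2) / 2 = -(x ^ 2 / 2) + y ^ 2 / 2 by ring]

/-- A convex function lies below its chord. -/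
lemma ConvexOn.le_chord {f : ℝ → ℝ} {s : Set ℝ} (hf : ConvexOn ℝ s f) {l u x : ℝ}
    (hl : l ∈ s) (hu : u ∈ s) (hlu : l < u) (hx : x ∈ Set.Icc l u) :
    f x ≤ (u * f l - l * f u) / (u - l) + (f u - f l) / (u - l) * x := by
  have hd : 0 < u - l := sub_pos.2 hlu
  have h := hf.2 hl hu (div_nonneg (sub_nonneg.2 hx.2) hd.le)
    (div_nonneg (sub_nonneg.2 hx.1) hd.le) (by field_simp; ring)
  simp only [smul_eq_mul] at h
  have hx' : (u - x) / (u - l) * l + (x - l) / (u - l) * u = x := by field_simp; ring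
  rw [hx'] at h
  refine h.trans_eq ?_
  field_simp
  ring

open Real in
/-- On `[e^{-ε}, e^ε]` the power `x ^ α` is below an affine function whose value at `1` is at most
`exp (α (α - 1) ε² / 2)`. -/
lemma exists_affine_rpow_le {ε α : ℝ} (hε : 0 ≤ ε) (hα : 1 ≤ α) :
    ∃ A B : ℝ, A + B ≤ exp (α * (α - 1) * ε ^ 2 / 2) ∧
      ∀ x ∈ Set.Icc (exp (-ε)) (exp ε), x ^ α ≤ A + B * x := by
  rcases hε.eq_or_lt with rfl | hε
  · refine ⟨1, 0, by simp, fun x hx => ?_⟩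
    obtain rfl : x = 1 := by simpa using hx
    simp
  refine ⟨_, _, ?_, fun x hx => (convexOn_rpow hα).le_chord
    (exp_pos (-ε)).le (exp_pos ε).le (exp_lt_exp.2 (by linarith)) hx⟩
  obtain ⟨t, rfl⟩ : ∃ t, ε = 2 * t := ⟨ε / 2, by ring⟩
  have ht : 0 < t := by linarith
  have key : cosh ((2 * α - 1) * t) ≤ cosh t * exp (α * (α - 1) * (2 * t) ^ 2 / 2) := by
    convert cosh_le_cosh_mul_exp ht.le (by nlinarith : t ≤ (2 * α - 1) * t) using 3
    ring
  rw [← div_le_iff₀' (cosh_pos t)] at key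
  refine le_trans (le_of_eq ?_) key
  have hS : 1 < exp t := one_lt_exp_iff.2 ht
  have hV : 0 < exp (2 * t * α) := exp_pos _
  have hu : exp (2 * t) = exp t ^ 2 := by rw [← exp_nat_mul]; norm_num
  have hc : exp ((2 * α - 1) * t) = exp (2 * t * α) / exp t := by rw [← exp_sub]; ring_nf
  rw [← exp_mul, ← exp_mul, cosh_eq, cosh_eq, neg_mul]
  simp only [exp_neg, hu, hc]
  generalize exp (2 * t * α) = V at *
  generalize exp t = S at *
  have h1 : S ^ 2 - 1 ≠ 0 := by nlinarith
  have h2 : S ^ 2 - (S ^ 2)⁻¹ ≠ 0 := by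
    have : (S ^ 2)⁻¹ < 1 := inv_lt_one_of_one_lt₀ (by nlinarith)
    nlinarith
  have h3 : 0 < S := by linarith
  have h4 : S ^ 4 - 1 ≠ 0 := by
    have : S ^ 4 - 1 = (S ^ 2 - 1) * (S ^ 2 + 1) := by ring
    rw [this]; positivity
  rw [← add_div, div_eq_div_iff h2 (by positivity)]
  field_simp
  ring

/-- DP to zCDP conversion, at the level of a pair of output densities: if
`e^{-ε} q ≤ p ≤ e^{ε} q` a.e., then `∫ p^α q^{1-α} ≤ exp(α(α-1)ε²/2)`,
i.e. the α-Rényi divergence is at most `(ε²/2)·α`. -/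
theorem dp_to_zcdp {Ω : Type*} [MeasurableSpace Ω] (μ : Measure Ω) [SigmaFinite μ]
    (p q : Ω → ℝ) (hp : Measurable p) (hq : Measurable q)
    (hp0 : ∀ ω, 0 ≤ p ω) (hq0 : ∀ ω, 0 ≤ q ω)
    (hpInt : ∫ ω, p ω ∂μ = 1) (hqInt : ∫ ω, q ω ∂μ = 1)
    (ε : ℝ) (hε : 0 ≤ ε)
    (hdp : ∀ᵐ ω ∂μ, Real.exp (-ε) * q ω ≤ p ω ∧ p ω ≤ Real.exp ε * q ω)
    (α : ℝ) (hα : 1 < α) :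
    ∫ ω, (p ω) ^ α * (q ω) ^ (1 - α) ∂μ ≤ Real.exp (α * (α - 1) * ε ^ 2 / 2) := by
  obtain ⟨A, B, hAB, hchord⟩ := exists_affine_rpow_le hε hα.le
  have hpI : Integrable p μ := .of_integral_ne_zero (by simp [hpInt])
  have hqI : Integrable q μ := .of_integral_ne_zero (by simp [hqInt])
  calc ∫ ω, (p ω) ^ α * (q ω) ^ (1 - α) ∂μ
      ≤ ∫ ω, A * q ω + B * p ω ∂μ := by
        refine integral_mono_of_nonneg
          (.of_forall fun ω => mul_nonneg (Real.rpow_nonneg (hp0 ω) _) (Real.rpow_nonneg (hq0 ω) _))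
          ((hqI.const_mul A).add (hpI.const_mul B)) ?_
        filter_upwards [hdp] with ω ⟨hlo, hhi⟩
        rcases (hq0 ω).eq_or_lt with h0 | hpos
        · have hp' : p ω = 0 := le_antisymm (by simpa [← h0] using hhi) (hp0 ω)
          simp [hp', ← h0, Real.zero_rpow (by linarith : α ≠ 0)]
        · have h := mul_le_mul_of_nonneg_right
            (hchord (p ω / q ω) ⟨(le_div_iff₀ hpos).2 hlo, (div_le_iff₀ hpos).2 hhi⟩) hpos.le
          rw [Real.div_rpow (hp0 ω) hpos.le] at h
          rw [Real.rpow_sub hpos, Real.rpow_one]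
          convert h using 1 <;> field_simp
    _ = A + B := by
        rw [integral_add (hqI.const_mul A) (hpI.const_mul B), integral_const_mul,
          integral_const_mul, hpInt, hqInt, mul_one, mul_one]
    _ ≤ _ := hAB
end
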